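/- Assume (H1), (H2) and upper Ahlfors regularity (H4′). Let ω < t and 0 < δ ≤ δ_Γ, and let Γ″ ⊆ A_{ω,δ} ∩ Γ_t be H^t-measurable with H^t(Γ″) < ∞. Let Tu : Γ″ → ℝ be H^t-measurable and such that for every x̄ ∈ Γ″, g(x;u) → Tu(x̄) as x → x̄ with x ∈ Q_{λ₀}(x̄). Then Tu ∈ W^{β,p}(Γ″) for every 0 < β < (t − ω)/p; that is, Tu ∈ Lᵖ(Γ″, H^t) and ∫_{Γ″}∫_{Γ″} |Tu(ȳ) − Tu(x̄)|ᵖ / ‖ȳ − x̄‖^{t+βp} dH^t(ȳ) dH^t(x̄) < ∞. -/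

import Mathlib

open MeasureTheory Metric Set Filter
open scoped ENNReal NNReal Topology

noncomputable section

abbrev Euc (n : ℕ) := EuclideanSpace ℝ (Fin n)

variable {n : ℕ}

/-- Distance to the boundary of `Ω`. -/
def dB (Ω : Set (Euc n)) (x : Euc n) : ℝ := infDist x (frontier Ω)

/-- `Ψ(x) = B(x, d(x)/2)`. -/
def PsiB (Ω : Set (Euc n)) (x : Euc n) : Set (Euc n) := ball x (dB Ω x / 2)

/-- `Φ(x) = B(x, d(x)/6)`. -/
def PhiB (Ω : Set (Euc n)) (x : Euc n) : Set (Euc n) := ball x (dB Ω x / 6)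

/-- The integrand of `ν(·;u)`. -/
def nuInt (Ω : Set (Euc n)) (s : Euc n → ℝ) (p : ℝ) (u : Euc n → ℝ) (x : Euc n) : ℝ :=
  (⨍ y in PsiB Ω x, |u y - u x|) ^ p * dB Ω x ^ (-(p * s x))

/-- `ν(E;u)`. -/
def nuM (Ω : Set (Euc n)) (s : Euc n → ℝ) (p : ℝ) (u : Euc n → ℝ) (E : Set (Euc n)) : ℝ :=
  ∫ x in Ω ∩ E, nuInt Ω s p u x

/-- Membership in the nonlocal space `𝒩^{s,p}(Ω)`: `u ∈ L¹(Ω)` and `ν(Ω;u) < ∞`. -/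
def MemN (Ω : Set (Euc n)) (s : Euc n → ℝ) (p : ℝ) (u : Euc n → ℝ) : Prop :=
  IntegrableOn u Ω volume ∧ IntegrableOn (nuInt Ω s p u) Ω volume

/-- `g(x;u)`, the mean of `u` over `Φ(x)`. -/
def gFun (Ω : Set (Euc n)) (u : Euc n → ℝ) (x : Euc n) : ℝ := ⨍ y in PhiB Ω x, u y

/-- The approach region `Q^θ_λ(xb)`. -/
def Qreg (Ω : Set (Euc n)) (lam θ : ℝ) (xb : Euc n) : Set (Euc n) :=
  {x | x ∈ Ω ∧ (lam * dist xb x) ^ θ < dB Ω x}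

/-- `Q` is an `(η,θ)`-corkscrew region for `xb` with radius `δ₀`. -/
def IsCorkscrew (Ω Q : Set (Euc n)) (xb : Euc n) (η θ δ₀ : ℝ) : Prop :=
  ∀ δ : ℝ, 0 < δ → δ ≤ δ₀ →
    ∃ x ∈ Q, η * δ < dist xb x ∧ dist xb x < δ ∧ (η * δ) ^ θ < dB Ω x

/-- `E` is `(C,θ)`-connected to `xb`, with radius `ρ₀` and gauge `ε`. -/
def ConnectedTo (Ω E : Set (Euc n)) (xb : Euc n) (C θ ρ₀ : ℝ) (ε : ℝ → ℝ) : Prop :=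
  ∀ lam : ℝ, 0 < lam → lam < 1 →
    0 < ε lam ∧ ε lam ≤ lam ∧
      ∀ ρ : ℝ, 0 < ρ → ρ ≤ ρ₀ → ∀ x ∈ E ∩ ball xb ρ, ∀ x' ∈ E ∩ ball xb ρ,
        (lam * ρ) ^ θ ≤ dB Ω x → (lam * ρ) ^ θ ≤ dB Ω x' →
        ∃ γ : ℝ → Euc n, ContinuousOn γ (Icc 0 1) ∧ γ 0 = x ∧ γ 1 = x' ∧
          (∀ τ ∈ Icc (0:ℝ) 1, γ τ ∈ E ∧ ε lam * ρ ^ θ ≤ dB Ω (γ τ)) ∧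
          eVariationOn γ (Icc 0 1) ≤ ENNReal.ofReal (C * ρ)

/-- The piecewise bilinear function `α(s,θ)`. -/
def alphaFun (n : ℕ) (p sv θ : ℝ) : ℝ :=
  if p * sv - n ≤ p - 1 then p * (1 - θ) + (p * sv - n) * θ
  else (1 - θ) + (p * sv - n)

/-- `s̲_δ(xb)`. -/
def sLow (Ω : Set (Euc n)) (s : Euc n → ℝ) (xb : Euc n) (δ : ℝ) : ℝ :=
  sInf (s '' (Ω ∩ ball xb δ))

/-- `α̲_δ(xb)`. -/
def alphaLow (Ω : Set (Euc n)) (s : Euc n → ℝ) (p : ℝ) (θΓ : Euc n → ℝ)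
    (xb : Euc n) (δ : ℝ) : ℝ :=
  alphaFun n p (sLow Ω s xb δ) (θΓ xb)

/-- `α̲_0(xb) = lim_{δ → 0⁺} α̲_δ(xb)`. -/
def alphaLow0 (Ω : Set (Euc n)) (s : Euc n → ℝ) (p : ℝ) (θΓ : Euc n → ℝ) (xb : Euc n) : ℝ :=
  limUnder (𝓝[>] (0:ℝ)) (fun δ => alphaLow Ω s p θΓ xb δ)

/-- `Γ_τ`: points of `Γ` where `limsup_{ρ→0⁺} ρ^{-τ} ν(B(xb,ρ);u) < ∞`. -/
def GammaTau (Ω : Set (Euc n)) (s : Euc n → ℝ) (p : ℝ) (u : Euc n → ℝ)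
    (Γ : Set (Euc n)) (τ : ℝ) : Set (Euc n) :=
  {xb ∈ Γ | ∃ M : ℝ, ∀ᶠ ρ in 𝓝[>] (0:ℝ), ρ ^ (-τ) * nuM Ω s p u (ball xb ρ) ≤ M}

/-- `M_τ(xb) = sup_{0<ρ≤δΓ} ρ^{-τ} ν(B(xb,ρ);u)`. -/
def Mtau (Ω : Set (Euc n)) (s : Euc n → ℝ) (p : ℝ) (u : Euc n → ℝ)
    (δΓ τ : ℝ) (xb : Euc n) : ℝ :=
  sSup ((fun ρ => ρ ^ (-τ) * nuM Ω s p u (ball xb ρ)) '' Ioc 0 δΓ)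

lemma ball_sub_Om {Ω : Set (Euc n)} (hΩo : IsOpen Ω) {x : Euc n} (hx : x ∈ Ω) :
    ball x (dB Ω x) ⊆ Ω := by
  intro y hy
  by_contra hyn
  have hpc : IsPreconnected (ball x (dB Ω x)) := (convex_ball x _).isPreconnected
  have hpos : 0 < dB Ω x := lt_of_le_of_lt dist_nonneg (mem_ball.1 hy)
  obtain ⟨z, hz, hzf⟩ : (ball x (dB Ω x) ∩ frontier Ω).Nonempty := by
    by_contra hemp
    rw [not_nonempty_iff_eq_empty] at hemp
    have hcl : ∀ z ∈ ball x (dB Ω x), z ∉ Ω → z ∈ (closure Ω)ᶜ := by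
      intro z hz hzn hzc
      have : z ∈ ball x (dB Ω x) ∩ frontier Ω := ⟨hz, by rw [hΩo.frontier_eq]; exact ⟨hzc, hzn⟩⟩
      rw [hemp] at this
      exact this
    obtain ⟨z, -, hz1, hz2⟩ := hpc Ω (closure Ω)ᶜ hΩo isClosed_closure.isOpen_compl
      (fun z hz => by
        by_cases h : z ∈ Ω
        · exact Or.inl h
        · exact Or.inr (hcl z hz h))
      ⟨x, mem_ball_self hpos, hx⟩ ⟨y, hy, hcl y hy hyn⟩
    exact hz2 (subset_closure hz1)
  have := infDist_le_dist_of_mem (x := x) hzf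
  rw [mem_ball, dist_comm] at hz
  unfold dB at hz
  linarith

lemma dB_le (Ω : Set (Euc n)) (x y : Euc n) : dB Ω x ≤ dB Ω y + dist x y :=
  infDist_le_infDist_add_dist

lemma vol_ball_real (x : Euc n) {r : ℝ} (hr : 0 < r) :
    (volume : Measure (Euc n)).real (ball x r) = r ^ n * (volume : Measure (Euc n)).real (ball 0 1) := by
  rw [measureReal_def, measureReal_def, Measure.addHaar_ball_of_pos _ _ hr, ENNReal.toReal_mul,
    ENNReal.toReal_ofReal (by positivity)]
  simp

lemma vol_one_pos : 0 < (volume : Measure (Euc n)).real (ball (0 : Euc n) 1) := by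
  rw [measureReal_def]
  exact ENNReal.toReal_pos (measure_ball_pos _ _ one_pos).ne' measure_ball_lt_top.ne

lemma mean_ball (u : Euc n → ℝ) (a b : Euc n) (r R c : ℝ) (hr : 0 < r) (hR : R ≤ 4 * r)
    (hsub : ball a r ⊆ ball b R) (hu : IntegrableOn u (ball b R) volume) :
    |(⨍ y in ball a r, u y) - c| ≤ 4 ^ n * ⨍ y in ball b R, |u y - c| := by
  have hv := vol_one_pos (n := n)
  have hR0 : 0 < R := by
    have : (ball b R).Nonempty := ⟨a, hsub (mem_ball_self hr)⟩
    exact nonempty_ball.1 this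
  have huc : IntegrableOn (fun y => u y - c) (ball b R) volume :=
    hu.sub (integrableOn_const measure_ball_lt_top.ne)
  have huc' : IntegrableOn (fun y => u y - c) (ball a r) volume := huc.mono_set hsub
  have hua : IntegrableOn u (ball a r) volume := hu.mono_set hsub
  have e1 : (⨍ y in ball a r, u y) - c = ⨍ y in ball a r, (u y - c) := by
    rw [setAverage_eq, setAverage_eq, integral_sub hua (integrableOn_const measure_ball_lt_top.ne),
      setIntegral_const, smul_sub, smul_smul, inv_mul_cancel₀, one_smul]
    rw [vol_ball_real a hr]; positivity
  rw [e1, setAverage_eq, setAverage_eq, vol_ball_real a hr, vol_ball_real b hR0,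
    smul_eq_mul, smul_eq_mul, abs_mul, abs_of_pos (by positivity)]
  have i1 : |∫ y in ball a r, (u y - c)| ≤ ∫ y in ball b R, |u y - c| := by
    refine (abs_integral_le_integral_abs).trans ?_
    apply setIntegral_mono_set huc.abs
    · exact Eventually.of_forall fun y => abs_nonneg _
    · exact hsub.eventuallyLE
  have i0 : 0 ≤ ∫ y in ball b R, |u y - c| := integral_nonneg fun y => abs_nonneg _
  set V := (volume : Measure (Euc n)).real (ball (0 : Euc n) 1)
  have i2 : (r ^ n * V)⁻¹ ≤ 4 ^ n * (R ^ n * V)⁻¹ := by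
    have : R ^ n ≤ 4 ^ n * r ^ n := by
      rw [← mul_pow]; exact pow_le_pow_left₀ hR0.le hR n
    rw [← div_eq_mul_inv, inv_eq_one_div, div_le_div_iff₀ (by positivity) (by positivity)]
    nlinarith
  calc _ ≤ (4 ^ n * (R ^ n * V)⁻¹) * ∫ y in ball b R, |u y - c| := by gcongr
    _ = _ := by ring

lemma step_pt {Ω : Set (Euc n)} (hΩo : IsOpen Ω) (u : Euc n → ℝ) (hu : IntegrableOn u Ω volume)
    {x y z : Euc n} (hx : x ∈ Ω) (hd : 0 < dB Ω x) (hxy : dist x y ≤ dB Ω x / 20)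
    (hz : z ∈ ball x (dB Ω x / 20)) :
    |gFun Ω u x - gFun Ω u y| ≤ 2 * 4 ^ n * ⨍ w in PsiB Ω z, |u w - u z| := by
  rw [mem_ball] at hz
  have h1 := dB_le Ω x y
  have h2 := dB_le Ω y x
  have h3 := dB_le Ω x z
  have h4 := dB_le Ω z x
  have hzO : z ∈ Ω := ball_sub_Om hΩo hx (by rw [mem_ball]; linarith)
  have hc1 := dist_comm x y
  have hc2 := dist_comm x z
  have hyz := dist_triangle y x z
  have hpsi : PsiB Ω z ⊆ Ω := by
    refine (ball_subset_ball ?_).trans (ball_sub_Om hΩo hzO)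
    linarith
  have huz : IntegrableOn u (PsiB Ω z) volume := hu.mono_set hpsi
  have A1 : |gFun Ω u x - u z| ≤ 4 ^ n * ⨍ w in PsiB Ω z, |u w - u z| := by
    apply mean_ball u _ _ _ _ _ (by linarith) (by linarith) _ huz
    apply ball_subset_ball'
    linarith
  have A2 : |gFun Ω u y - u z| ≤ 4 ^ n * ⨍ w in PsiB Ω z, |u w - u z| := by
    apply mean_ball u _ _ _ _ _ (by linarith) (by linarith) _ huz
    apply ball_subset_ball'
    linarith
  calc |gFun Ω u x - gFun Ω u y| ≤ |gFun Ω u x - u z| + |u z - gFun Ω u y| := abs_sub_le _ _ _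
    _ ≤ _ := by rw [abs_sub_comm (u z)]; linarith

/-- the measure `ν`. -/
def NUm (Ω : Set (Euc n)) (s : Euc n → ℝ) (p : ℝ) (u : Euc n → ℝ) : Measure (Euc n) :=
  (volume.restrict Ω).withDensity (fun x => ENNReal.ofReal (nuInt Ω s p u x))

lemma NUm_fin {Ω : Set (Euc n)} {s : Euc n → ℝ} {p : ℝ} {u : Euc n → ℝ} (hu : MemN Ω s p u) :
    IsFiniteMeasure (NUm Ω s p u) :=
  isFiniteMeasure_withDensity_ofReal hu.2.2

lemma step_nu {Ω : Set (Euc n)} (hΩo : IsOpen Ω) (s : Euc n → ℝ) (p : ℝ) (hp : 1 ≤ p)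
    (u : Euc n → ℝ) (hu : MemN Ω s p u)
    {x y : Euc n} (hx : x ∈ Ω) (hd : 0 < dB Ω x) (hxy : dist x y ≤ dB Ω x / 20)
    (sb sM : ℝ) (hsb0 : 0 ≤ sb) (hsbM : sb ≤ sM)
    (hs : ∀ z ∈ ball x (dB Ω x / 20), sb ≤ s z ∧ dB Ω z ≤ 1) :
    |gFun Ω u x - gFun Ω u y| ^ p ≤
      ((2 * 4 ^ n) ^ p * 2 ^ (p * sM) * 20 ^ n / (volume : Measure (Euc n)).real (ball (0 : Euc n) 1)) *
        dB Ω x ^ (p * sb - n) * (NUm Ω s p u).real (ball x (dB Ω x / 20)) := by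
  have := NUm_fin hu
  have hp0 : 0 < p := by linarith
  set V := (volume : Measure (Euc n)).real (ball (0 : Euc n) 1) with hV
  have hVpos : 0 < V := vol_one_pos
  set d := dB Ω x with hdd
  set B := ball x (d / 20) with hB
  have hBO : B ⊆ Ω := (ball_subset_ball (by linarith)).trans (ball_sub_Om hΩo hx)
  set D := |gFun Ω u x - gFun Ω u y| with hD
  set K : ℝ := (2 * 4 ^ n) ^ p * 2 ^ (p * sM) * d ^ (p * sb) with hK
  have hK0 : 0 ≤ K := by positivity
  have pt : ∀ z ∈ B, D ^ p ≤ K * nuInt Ω s p u z := by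
    intro z hz
    obtain ⟨hs1, hs2⟩ := hs z hz
    have h1 := step_pt hΩo u hu.1 hx hd hxy hz
    rw [hB, mem_ball] at hz
    have h3 := dB_le Ω x z
    have h4 := dB_le Ω z x
    rw [← hdd] at h3 h4
    rw [dist_comm] at h3
    have hdz : 0 < dB Ω z := by linarith
    have hdz2 : dB Ω z ≤ 2 * d := by linarith
    set m := ⨍ w in PsiB Ω z, |u w - u z| with hm
    have hm0 : 0 ≤ m := by
      rw [hm, setAverage_eq]
      exact smul_nonneg (by positivity) (integral_nonneg fun _ => abs_nonneg _)
    have e : nuInt Ω s p u z = m ^ p * dB Ω z ^ (-(p * s z)) := rfl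
    have hA : D ^ p ≤ (2 * 4 ^ n) ^ p * m ^ p := by
      rw [← Real.mul_rpow (by positivity) hm0]
      exact Real.rpow_le_rpow (abs_nonneg _) h1 hp0.le
    have hW : 1 ≤ 2 ^ (p * sM) * d ^ (p * sb) * dB Ω z ^ (-(p * s z)) := by
      have w1 : dB Ω z ^ (-(p * sb)) ≤ dB Ω z ^ (-(p * s z)) := by
        apply Real.rpow_le_rpow_of_exponent_ge hdz hs2
        have := mul_le_mul_of_nonneg_left hs1 hp0.le
        linarith
      have w2 : (1:ℝ) ≤ 2 ^ (p * sM) * d ^ (p * sb) * dB Ω z ^ (-(p * sb)) := by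
        rw [Real.rpow_neg hdz.le, ← div_eq_mul_inv, le_div_iff₀ (by positivity), one_mul]
        calc dB Ω z ^ (p * sb) ≤ (2 * d) ^ (p * sb) :=
              Real.rpow_le_rpow hdz.le hdz2 (by positivity)
          _ = 2 ^ (p * sb) * d ^ (p * sb) := Real.mul_rpow (by norm_num) hd.le
          _ ≤ _ := by
            gcongr
            norm_num
      calc (1:ℝ) ≤ _ := w2
        _ ≤ _ := by gcongr
    calc D ^ p ≤ (2 * 4 ^ n) ^ p * m ^ p * 1 := by rw [mul_one]; exact hA
      _ ≤ (2 * 4 ^ n) ^ p * m ^ p * (2 ^ (p * sM) * d ^ (p * sb) * dB Ω z ^ (-(p * s z))) := by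
        gcongr
      _ = _ := by rw [e, hK]; ring
  have hNU : NUm Ω s p u B = ∫⁻ z in B, ENNReal.ofReal (nuInt Ω s p u z) := by
    rw [NUm, withDensity_apply _ measurableSet_ball, Measure.restrict_restrict measurableSet_ball,
      inter_eq_left.2 hBO]
  have hI : ENNReal.ofReal (D ^ p) * volume B ≤ ENNReal.ofReal K * NUm Ω s p u B := by
    rw [hNU, ← lintegral_const_mul' _ _ ENNReal.ofReal_ne_top, ← setLIntegral_const]
    apply setLIntegral_mono' measurableSet_ball
    intro z hz
    rw [← ENNReal.ofReal_mul hK0]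
    exact ENNReal.ofReal_le_ofReal (pt z hz)
  have hI2 : D ^ p * (volume : Measure (Euc n)).real B ≤ K * (NUm Ω s p u).real B := by
    have := ENNReal.toReal_mono (ENNReal.mul_ne_top ENNReal.ofReal_ne_top (measure_ne_top _ _)) hI
    rw [ENNReal.toReal_mul, ENNReal.toReal_mul, ENNReal.toReal_ofReal (by positivity),
      ENNReal.toReal_ofReal hK0] at this
    exact this
  rw [hB, vol_ball_real x (by positivity), ← hB, ← hV] at hI2
  have hpos : 0 < (d / 20) ^ n * V := by positivity
  rw [← le_div_iff₀ hpos] at hI2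
  refine hI2.trans (le_of_eq ?_)
  rw [Real.rpow_sub hd, Real.rpow_natCast, hK, div_pow]
  field_simp

lemma chain_aux (γ : ℝ → Euc n) (hc : ContinuousOn γ (Icc 0 1)) (f r : Euc n → ℝ) (A m D : ℝ)
    (hA : 0 ≤ A) (hm : 0 < m) (hr : ∀ τ ∈ Icc (0:ℝ) 1, m ≤ r (γ τ) ∧ r (γ τ) ≤ D)
    (hstep : ∀ τ ∈ Icc (0:ℝ) 1, ∀ τ' ∈ Icc (0:ℝ) 1, dist (γ τ) (γ τ') ≤ r (γ τ) →
      |f (γ τ) - f (γ τ')| ≤ A * r (γ τ)) :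
    ∀ k : ℕ, ∀ τ ∈ Icc (0:ℝ) 1, ∀ L : ℝ, 0 ≤ L → L ≤ k * m →
      eVariationOn γ (Icc τ 1) ≤ ENNReal.ofReal L → |f (γ τ) - f (γ 1)| ≤ A * (L + D) := by
  intro k
  induction k with
  | zero =>
    intro τ hτ L hL0 hL hV
    have h1 : edist (γ τ) (γ 1) ≤ ENNReal.ofReal L :=
      (eVariationOn.edist_le γ (left_mem_Icc.2 hτ.2) (right_mem_Icc.2 hτ.2)).trans hV
    rw [edist_dist, ENNReal.ofReal_le_ofReal_iff hL0] at h1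
    simp only [Nat.cast_zero, zero_mul] at hL
    obtain ⟨hr1, hr2⟩ := hr τ hτ
    refine (hstep τ hτ 1 (by simp) (by linarith)).trans ?_
    gcongr; linarith
  | succ k ih =>
    intro τ hτ L hL0 hL hV
    obtain ⟨hr1, hr2⟩ := hr τ hτ
    by_cases hd : dist (γ τ) (γ 1) ≤ r (γ τ)
    · refine (hstep τ hτ 1 (by simp) hd).trans ?_
      gcongr; linarith
    · push Not at hd
      have hsub : Icc τ 1 ⊆ Icc (0:ℝ) 1 := Icc_subset_Icc_left hτ.1
      have hcont : ContinuousOn (fun σ => dist (γ τ) (γ σ)) (Icc τ 1) :=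
        fun σ hσ => Filter.Tendsto.dist tendsto_const_nhds ((hc.mono hsub) σ hσ)
      have hiv := intermediate_value_Icc hτ.2 hcont
      obtain ⟨σ, hσ, hσe⟩ := hiv (show r (γ τ) ∈ Icc (dist (γ τ) (γ τ)) (dist (γ τ) (γ 1)) from
        ⟨by rw [dist_self]; linarith, hd.le⟩)
      simp only at hσe
      have hadd := eVariationOn.Icc_add_Icc γ (s := univ) hσ.1 hσ.2 (mem_univ _)
      simp only [univ_inter] at hadd
      have h1 : ENNReal.ofReal (r (γ τ)) ≤ eVariationOn γ (Icc τ σ) := by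
        rw [← hσe, ← edist_dist]
        exact eVariationOn.edist_le γ (left_mem_Icc.2 hσ.1) (right_mem_Icc.2 hσ.1)
      have h2 : ENNReal.ofReal (r (γ τ)) + eVariationOn γ (Icc σ 1) ≤ ENNReal.ofReal L := by
        rw [← hadd] at hV
        exact (add_le_add_left h1 _).trans hV
      have hrL : r (γ τ) ≤ L := by
        rw [← ENNReal.ofReal_le_ofReal_iff hL0]
        exact le_self_add.trans h2
      have h3 : eVariationOn γ (Icc σ 1) ≤ ENNReal.ofReal (L - r (γ τ)) := by
        rw [ENNReal.ofReal_sub _ (by linarith)]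
        exact ENNReal.le_sub_of_add_le_left ENNReal.ofReal_ne_top h2
      have h4 := ih σ (hsub hσ) (L - r (γ τ)) (by linarith) (by push_cast at hL; linarith) h3
      have h5 := hstep τ hτ σ (hsub hσ) hσe.le
      calc |f (γ τ) - f (γ 1)| ≤ |f (γ τ) - f (γ σ)| + |f (γ σ) - f (γ 1)| := abs_sub_le _ _ _
        _ ≤ _ := by linarith

lemma alpha_le1 (p sv θ : ℝ) (hθ : 1 ≤ θ) (_hq : p * sv - n ≤ p) :
    alphaFun n p sv θ ≤ p + θ * (p * sv - n - p) := by
  unfold alphaFun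
  split_ifs with h
  · nlinarith
  · push Not at h
    nlinarith [mul_nonneg (sub_nonneg.2 hθ) (sub_nonneg.2 h.le)]

lemma alpha_le2 (p sv θ : ℝ) (hθ : 1 ≤ θ) (hq : p < p * sv - n) :
    alphaFun n p sv θ ≤ p * sv - n := by
  unfold alphaFun
  rw [if_neg (by linarith)]
  linarith

lemma conn (p CΓ δΓ ω : ℝ) (hp : 1 ≤ p) (hCΓ : 1 ≤ CΓ) (hδΓ1 : δΓ < 1)
    (Ω : Set (Euc n)) (hΩo : IsOpen Ω)
    (Γ : Set (Euc n)) (hΓfr : Γ ⊆ frontier Ω)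
    (θΓ : Euc n → ℝ) (hθ1 : ∀ xb, 1 ≤ θΓ xb)
    (s : Euc n → ℝ) (hs0 : ∀ x, 0 ≤ s x) (sM : ℝ) (hsM : ∀ x, s x ≤ sM)
    (ε : ℝ → ℝ)
    (H2 : ∀ xb ∈ Γ, ConnectedTo Ω (Ω ∩ ball xb δΓ) xb CΓ (θΓ xb) (δΓ / (3 * CΓ)) ε)
    (u : Euc n → ℝ) (hu : MemN Ω s p u)
    (δ : ℝ) (hδΓ' : δ ≤ δΓ) (lam : ℝ) (hlam : 0 < lam) (hlam1 : lam < 1) :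
    ∃ K : ℝ, 0 ≤ K ∧ ∀ xb ∈ Γ, 0 ≤ alphaLow Ω s p θΓ xb δ + ω → ∀ ρ : ℝ, 0 < ρ →
      ρ ≤ δΓ / (3 * CΓ) → 2 * (CΓ + 1) * ρ ≤ δ → ∀ x ∈ Ω ∩ ball xb ρ, ∀ x' ∈ Ω ∩ ball xb ρ,
      (lam * ρ) ^ (θΓ xb) ≤ dB Ω x → (lam * ρ) ^ (θΓ xb) ≤ dB Ω x' →
      |gFun Ω u x - gFun Ω u x'| ^ p ≤
        K * ρ ^ (-ω) * (NUm Ω s p u).real (ball xb (2 * (CΓ + 1) * ρ)) := by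
  have := NUm_fin hu
  have hp0 : 0 < p := by linarith
  have hsM0 : 0 ≤ sM := (hs0 0).trans (hsM 0)
  have hVpos := vol_one_pos (n := n)
  set K1 : ℝ := (2 * 4 ^ n) ^ p * 2 ^ (p * sM) * 20 ^ n /
    (volume : Measure (Euc n)).real (ball (0 : Euc n) 1) with hK1
  have hK10 : 0 ≤ K1 := by positivity
  by_cases hΓe : Γ = ∅
  · exact ⟨0, le_rfl, fun xb hxb => by simp [hΓe] at hxb⟩
  obtain ⟨xb0, hxb0⟩ := nonempty_iff_ne_empty.2 hΓe
  obtain ⟨he0, he1, -⟩ := H2 xb0 hxb0 lam hlam hlam1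
  set e := ε lam with he
  set K2 : ℝ := e ^ (-(n + p) : ℝ) + (CΓ + 1) ^ (p * sM) with hK2
  have hK20 : 0 ≤ K2 := by positivity
  refine ⟨20 ^ p * K1 * (2 * (CΓ + 1)) ^ p * K2, by positivity, ?_⟩
  intro xb hxb hα ρ hρ0 hρ1 hρδ x hx x' hx' hdx hdx'
  have hxρ : dist x xb < ρ := hx.2
  have hx'ρ : dist x' xb < ρ := hx'.2
  have hρδΓ : ρ ≤ δΓ := by nlinarith
  have hρle1 : ρ ≤ 1 := by linarith
  obtain ⟨-, -, hcon⟩ := H2 xb hxb lam hlam hlam1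
  have hEsub : ball xb ρ ⊆ ball xb δΓ := ball_subset_ball hρδΓ
  obtain ⟨γ, hγc, hγ0, hγ1, hγm, hγV⟩ := hcon ρ hρ0 hρ1 x ⟨⟨hx.1, hEsub hx.2⟩, hx.2⟩
    x' ⟨⟨hx'.1, hEsub hx'.2⟩, hx'.2⟩ hdx hdx'
  set θ := θΓ xb with hθ
  have hθ1' : 1 ≤ θ := hθ1 xb
  set m := e * ρ ^ θ with hm
  have hm0 : 0 < m := by positivity
  set D := (CΓ + 1) * ρ with hD
  have hD0 : 0 < D := by positivity
  set sb := sLow Ω s xb δ with hsb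
  have hbdd : BddBelow (s '' (Ω ∩ ball xb δ)) := ⟨0, by rintro _ ⟨y, -, rfl⟩; exact hs0 y⟩
  have hsble : ∀ z ∈ Ω ∩ ball xb δ, sb ≤ s z := fun z hz => csInf_le hbdd ⟨z, hz, rfl⟩
  have hsb0 : 0 ≤ sb := Real.sInf_nonneg (by rintro _ ⟨y, -, rfl⟩; exact hs0 y)
  have hsbM : sb ≤ sM := by
    refine (hsble x ⟨hx.1, ball_subset_ball ?_ hx.2⟩).trans (hsM x)
    nlinarith
  set q : ℝ := p * sb - n with hq
  set N := (NUm Ω s p u).real (ball xb (2 * (CΓ + 1) * ρ)) with hN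
  have hN0 : 0 ≤ N := measureReal_nonneg
  set Bp : ℝ := if q ≤ p then m ^ (q - p) else D ^ (q - p) with hBp
  have hBp0 : 0 ≤ Bp := by rw [hBp]; split_ifs <;> positivity
  -- points on path
  have hdist : ∀ τ ∈ Icc (0:ℝ) 1, dist (γ τ) xb ≤ D := by
    intro τ hτ
    have h1 : edist (γ τ) (γ 0) ≤ ENNReal.ofReal (CΓ * ρ) :=
      (eVariationOn.edist_le γ hτ (by simp)).trans hγV
    rw [edist_dist, ENNReal.ofReal_le_ofReal_iff (by positivity), hγ0] at h1
    have := dist_triangle (γ τ) x xb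
    rw [hD]; linarith
  have hdBD : ∀ y, dB Ω y ≤ dist y xb := fun y => infDist_le_dist_of_mem (hΓfr hxb)
  have hstep : ∀ τ ∈ Icc (0:ℝ) 1, ∀ τ' ∈ Icc (0:ℝ) 1,
      dist (γ τ) (γ τ') ≤ dB Ω (γ τ) / 20 →
      |gFun Ω u (γ τ) - gFun Ω u (γ τ')| ≤ (20 * (K1 * Bp * N) ^ (1 / p)) * (dB Ω (γ τ) / 20) := by
    intro τ hτ τ' hτ' hdd
    obtain ⟨⟨hO, -⟩, hmd⟩ := hγm τ hτ
    have hd0 : 0 < dB Ω (γ τ) := hm0.trans_le hmd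
    have hdD : dB Ω (γ τ) ≤ D := (hdBD _).trans (hdist τ hτ)
    have hball : ball (γ τ) (dB Ω (γ τ) / 20) ⊆ ball xb (2 * (CΓ + 1) * ρ) := by
      apply ball_subset_ball'
      have := hdist τ hτ
      rw [hD] at *
      linarith
    have h1 := step_nu hΩo s p hp u hu hO hd0 hdd sb sM hsb0 hsbM (by
      intro z hz
      have hz1 := hball hz
      have hz2 : z ∈ ball xb δ := ball_subset_ball hρδ hz1
      refine ⟨hsble z ⟨ball_sub_Om hΩo hO (ball_subset_ball (by linarith) hz), hz2⟩, ?_⟩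
      have := hdBD z
      rw [mem_ball] at hz2
      linarith)
    rw [← hK1, ← hq] at h1
    set d := dB Ω (γ τ) with hd
    have h2 : d ^ q ≤ Bp * d ^ p := by
      have : d ^ q = d ^ (q - p) * d ^ p := by rw [← Real.rpow_add hd0]; ring_nf
      rw [this]
      gcongr
      rw [hBp]
      split_ifs with hqp
      · exact Real.rpow_le_rpow_of_nonpos hm0 hmd (by linarith)
      · exact Real.rpow_le_rpow hd0.le hdD (by linarith)
    have h3 : |gFun Ω u (γ τ) - gFun Ω u (γ τ')| ^ p ≤ (K1 * Bp * N) * d ^ p := by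
      calc _ ≤ _ := h1
        _ ≤ K1 * (Bp * d ^ p) * N := by
          gcongr
          exact measureReal_mono hball
        _ = _ := by ring
    calc |gFun Ω u (γ τ) - gFun Ω u (γ τ')|
        = (|gFun Ω u (γ τ) - gFun Ω u (γ τ')| ^ p) ^ (1 / p) := by
          rw [one_div, Real.rpow_rpow_inv (abs_nonneg _) hp0.ne']
      _ ≤ ((K1 * Bp * N) * d ^ p) ^ (1 / p) := by gcongr
      _ = (K1 * Bp * N) ^ (1 / p) * d := by
          rw [Real.mul_rpow (by positivity) (by positivity), one_div,
            Real.rpow_rpow_inv hd0.le hp0.ne']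
      _ = _ := by ring
  obtain ⟨k, hk⟩ := exists_nat_ge (CΓ * ρ / (m / 20))
  have hchain := chain_aux γ hγc (gFun Ω u) (fun y => dB Ω y / 20)
    (20 * (K1 * Bp * N) ^ (1 / p)) (m / 20) (D / 20) (by positivity) (by positivity)
    (fun τ hτ => ⟨by have := (hγm τ hτ).2; linarith, by
      have := (hdBD (γ τ)).trans (hdist τ hτ); linarith⟩) hstep k 0 (by simp) (CΓ * ρ)
      (by positivity) (by rwa [div_le_iff₀ (by positivity)] at hk) hγV
  rw [hγ0, hγ1] at hchain
  have hfin : |gFun Ω u x - gFun Ω u x'| ≤ 20 * (K1 * Bp * N) ^ (1 / p) * (2 * (CΓ + 1) * ρ) := by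
    refine hchain.trans ?_
    gcongr
    rw [hD]; nlinarith
  have hpow : |gFun Ω u x - gFun Ω u x'| ^ p ≤
      20 ^ p * (K1 * Bp * N) * ((2 * (CΓ + 1)) ^ p * ρ ^ p) := by
    calc _ ≤ (20 * (K1 * Bp * N) ^ (1 / p) * (2 * (CΓ + 1) * ρ)) ^ p := by gcongr
      _ = _ := by
        rw [Real.mul_rpow (by positivity) (by positivity), Real.mul_rpow (by positivity)
          (by positivity), Real.mul_rpow (x := 2 * (CΓ + 1)) (by positivity) (by positivity), one_div,
          Real.rpow_inv_rpow (by positivity) hp0.ne']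
  have hkey : Bp * ρ ^ p ≤ K2 * ρ ^ (-ω) := by
    have hα' : -ω ≤ alphaFun n p sb θ := by
      have : alphaLow Ω s p θΓ xb δ = alphaFun n p sb θ := rfl
      rw [this] at hα; linarith
    rw [hBp]
    split_ifs with hqp
    · have ha := alpha_le1 (n := n) p sb θ hθ1' hqp
      have e1 : m ^ (q - p) * ρ ^ p = e ^ (q - p) * ρ ^ (p + θ * (q - p)) := by
        rw [hm, Real.mul_rpow he0.le (by positivity), ← Real.rpow_mul hρ0.le, mul_assoc,
          ← Real.rpow_add hρ0]
        ring_nf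
      rw [e1]
      have e2 : e ^ (q - p) ≤ K2 := by
        have : e ^ (q - p) ≤ e ^ (-(n + p) : ℝ) := by
          apply Real.rpow_le_rpow_of_exponent_ge he0 (by linarith)
          have : 0 ≤ p * sb := by positivity
          linarith
        have : 0 ≤ (CΓ + 1) ^ (p * sM) := by positivity
        linarith
      have e3 : ρ ^ (p + θ * (q - p)) ≤ ρ ^ (-ω) :=
        Real.rpow_le_rpow_of_exponent_ge hρ0 hρle1 (by linarith)
      gcongr
    · push Not at hqp
      have ha := alpha_le2 (n := n) p sb θ hθ1' hqp
      have e1 : D ^ (q - p) * ρ ^ p = (CΓ + 1) ^ (q - p) * ρ ^ q := by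
        rw [hD, Real.mul_rpow (by positivity) (by positivity), mul_assoc,
          ← Real.rpow_add hρ0]
        ring_nf
      rw [e1]
      have e2 : (CΓ + 1) ^ (q - p) ≤ K2 := by
        have : (CΓ + 1) ^ (q - p) ≤ (CΓ + 1) ^ (p * sM) := by
          apply Real.rpow_le_rpow_of_exponent_le (by linarith)
          have : p * sb ≤ p * sM := by gcongr
          have : (0:ℝ) ≤ n := by positivity
          linarith
        have : 0 ≤ e ^ (-(n + p) : ℝ) := by positivity
        linarith
      have e3 : ρ ^ q ≤ ρ ^ (-ω) :=
        Real.rpow_le_rpow_of_exponent_ge hρ0 hρle1 (by linarith)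
      gcongr
  calc _ ≤ _ := hpow
    _ = 20 ^ p * K1 * (2 * (CΓ + 1)) ^ p * N * (Bp * ρ ^ p) := by ring
    _ ≤ 20 ^ p * K1 * (2 * (CΓ + 1)) ^ p * N * (K2 * ρ ^ (-ω)) := by gcongr
    _ = _ := by ring

lemma rho_rpow (ρ0 a : ℝ) (hρ0 : 0 < ρ0) (j : ℕ) :
    (ρ0 * (1 / 2) ^ j) ^ a = ρ0 ^ a * ((1 / 2 : ℝ) ^ a) ^ j := by
  rw [Real.mul_rpow hρ0.le (by positivity), ← Real.rpow_natCast, ← Real.rpow_natCast,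
    ← Real.rpow_mul (by norm_num), ← Real.rpow_mul (by norm_num), mul_comm (j : ℝ)]

lemma half_rpow_lt (a : ℝ) (ha : 0 < a) : (1 / 2 : ℝ) ^ a < 1 :=
  Real.rpow_lt_one (by norm_num) (by norm_num) ha

lemma sum_fin (ρ0 a : ℝ) (hρ0 : 0 < ρ0) (ha : 0 < a) :
    ∑' j : ℕ, ENNReal.ofReal ((ρ0 * (1 / 2) ^ j) ^ a) ≠ ⊤ := by
  apply Summable.tsum_ofReal_ne_top
  simp_rw [rho_rpow ρ0 a hρ0]
  exact (summable_geometric_of_lt_one (by positivity) (half_rpow_lt a ha)).mul_left _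

lemma geo_sum (p σ ρ0 M a : ℝ) (hp : 1 ≤ p) (hσ : 0 < σ) (hρ0 : 0 < ρ0) (hM : 0 ≤ M) (f : ℕ → ℝ)
    (hf : ∀ j, |f j - f (j + 1)| ^ p ≤ M * (ρ0 * (1 / 2) ^ j) ^ σ)
    (ha : Tendsto f atTop (𝓝 a)) (j : ℕ) :
    |f j - a| ^ p ≤ M * (ρ0 * (1 / 2) ^ j) ^ σ / (1 - (1 / 2 : ℝ) ^ (σ / p)) ^ p := by
  have hp0 : 0 < p := by linarith
  have hr := half_rpow_lt (σ / p) (by positivity)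
  set r := (1 / 2 : ℝ) ^ (σ / p) with hrdef
  have hr0 : 0 ≤ r := by positivity
  have key : ∀ j : ℕ, (M ^ (1 / p) * ρ0 ^ (σ / p) * r ^ j) = (M * (ρ0 * (1 / 2) ^ j) ^ σ) ^ (1 / p) := by
    intro j
    rw [Real.mul_rpow hM (by positivity), ← Real.rpow_mul (by positivity), mul_one_div,
      rho_rpow _ _ hρ0, mul_assoc]
  have h1 : ∀ j, dist (f j) (f (j + 1)) ≤ M ^ (1 / p) * ρ0 ^ (σ / p) * r ^ j := by
    intro j
    rw [key, Real.dist_eq]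
    calc _ = (|f j - f (j + 1)| ^ p) ^ (1 / p) := by
          rw [one_div, Real.rpow_rpow_inv (abs_nonneg _) hp0.ne']
      _ ≤ _ := by gcongr; exact hf j
  have h2 := dist_le_of_le_geometric_of_tendsto r _ hr h1 ha j
  rw [key, Real.dist_eq] at h2
  have h1r : 0 < 1 - r := by linarith
  calc _ ≤ ((M * (ρ0 * (1 / 2) ^ j) ^ σ) ^ (1 / p) / (1 - r)) ^ p := by gcongr
    _ = _ := by
      rw [Real.div_rpow (by positivity) h1r.le, one_div p, Real.rpow_inv_rpow (by positivity) hp0.ne']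

lemma three_pow (p a b c A : ℝ) (hp : 1 ≤ p) (ha : 0 ≤ a) (hb : 0 ≤ b) (hc : 0 ≤ c)
    (hA : a ^ p ≤ A) (hB : b ^ p ≤ A) (hC : c ^ p ≤ A) : (a + b + c) ^ p ≤ 3 ^ p * A := by
  have hp0 : 0 < p := by linarith
  have hA0 : 0 ≤ A := le_trans (by positivity) hA
  have aux : ∀ x : ℝ, 0 ≤ x → x ^ p ≤ A → x ≤ A ^ (1 / p) := by
    intro x hx h
    calc x = (x ^ p) ^ (1 / p) := by rw [one_div, Real.rpow_rpow_inv hx hp0.ne']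
      _ ≤ _ := by gcongr
  have : a + b + c ≤ 3 * A ^ (1 / p) := by
    have := aux a ha hA
    have := aux b hb hB
    have := aux c hc hC
    linarith
  calc _ ≤ (3 * A ^ (1 / p)) ^ p := by gcongr
    _ = _ := by
      rw [Real.mul_rpow (by norm_num) (by positivity), one_div, Real.rpow_inv_rpow hA0 hp0.ne']

lemma g_bdd {Ω : Set (Euc n)} (hΩo : IsOpen Ω) (u : Euc n → ℝ) (hu : IntegrableOn u Ω volume)
    {x : Euc n} (hx : x ∈ Ω) (c : ℝ) (hc : 0 < c) (hd : c ≤ dB Ω x) :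
    |gFun Ω u x| ≤ ((c / 6) ^ n * (volume : Measure (Euc n)).real (ball (0 : Euc n) 1))⁻¹ *
      ∫ y in Ω, |u y| := by
  have hv := vol_one_pos (n := n)
  have hsub : ball x (dB Ω x / 6) ⊆ Ω :=
    (ball_subset_ball (by linarith)).trans (ball_sub_Om hΩo hx)
  rw [gFun, PhiB, setAverage_eq, vol_ball_real x (by linarith), smul_eq_mul, abs_mul,
    abs_of_pos (by have : 0 < dB Ω x := by linarith
                   positivity)]
  have i1 : |∫ y in ball x (dB Ω x / 6), u y| ≤ ∫ y in Ω, |u y| := by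
    refine (abs_integral_le_integral_abs).trans ?_
    apply setIntegral_mono_set hu.abs
    · exact Eventually.of_forall fun y => abs_nonneg _
    · exact hsub.eventuallyLE
  gcongr

lemma meas_ball_measurable (ν : Measure (Euc n)) [SFinite ν] (r : ℝ) :
    Measurable (fun x => ν (ball x r)) := by
  have hs : MeasurableSet {q : Euc n × Euc n | dist q.2 q.1 < r} :=
    (isOpen_lt (continuous_snd.dist continuous_fst) continuous_const).measurableSet
  exact measurable_measure_prodMk_left hs

lemma ball_swap (μ ν : Measure (Euc n)) [SFinite μ] [SFinite ν] (r : ℝ) :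
    ∫⁻ x, ν (ball x r) ∂μ = ∫⁻ y, μ (ball y r) ∂ν := by
  have hs : MeasurableSet {q : Euc n × Euc n | dist q.2 q.1 < r} :=
    (isOpen_lt (continuous_snd.dist continuous_fst) continuous_const).measurableSet
  have h1 := Measure.prod_apply (μ := μ) (ν := ν) hs
  have h2 := Measure.prod_apply_symm (μ := μ) (ν := ν) hs
  rw [h1] at h2
  convert h2 using 4 with x x
  all_goals
    ext y
    simp [dist_comm]

lemma double_int {X : Type} [MetricSpace X] [MeasurableSpace X] [BorelSpace X]
    [SecondCountableTopology X] (μ : Measure (X)) [IsFiniteMeasure μ] (S : X → ℝ≥0∞) (hS : Measurable S)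
    (κ : ℝ → ℝ≥0∞) (hκ : Measurable κ) (I : ℝ≥0∞) (hI : I ≠ ⊤)
    (hκI : ∀ x, ∫⁻ y, κ (dist x y) ∂μ ≤ I) (hSI : ∫⁻ x, S x ∂μ ≠ ⊤) :
    ∫⁻ x, ∫⁻ y, (S x + S y + 1) * κ (dist x y) ∂μ ∂μ ≠ ⊤ := by
  have hm : Measurable (fun q : X × X => κ (dist q.1 q.2)) :=
    hκ.comp (continuous_fst.dist continuous_snd).measurable
  have hmx : ∀ x : X, Measurable (fun y => κ (dist x y)) := fun x =>
    hm.comp measurable_prodMk_left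
  have e1 : ∀ x, ∫⁻ y, (S x + S y + 1) * κ (dist x y) ∂μ =
      (S x + 1) * ∫⁻ y, κ (dist x y) ∂μ + ∫⁻ y, S y * κ (dist x y) ∂μ := by
    intro x
    rw [← lintegral_const_mul _ (hmx x), ← lintegral_add_left ((hmx x).const_mul _)]
    congr 1; ext y; ring
  have b1 : ∫⁻ x, (S x + 1) * I ∂μ ≠ ⊤ := by
    rw [lintegral_mul_const _ (hS.add_const _), lintegral_add_right _ measurable_const]
    refine ENNReal.mul_ne_top (ENNReal.add_ne_top.2 ⟨hSI, ?_⟩) hI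
    simp
  have b2 : ∫⁻ x, ∫⁻ y, S y * κ (dist x y) ∂μ ∂μ ≤ ∫⁻ y, S y * I ∂μ := by
    rw [lintegral_lintegral_swap ((hS.comp measurable_snd).mul hm).aemeasurable]
    apply lintegral_mono
    intro y
    simp only
    rw [lintegral_const_mul]
    · gcongr
      simp_rw [dist_comm _ y]
      exact hκI y
    · simp_rw [dist_comm _ y]; exact hmx y
  have b3 : ∫⁻ y, S y * I ∂μ ≠ ⊤ := by
    rw [lintegral_mul_const _ hS]
    exact ENNReal.mul_ne_top hSI hI
  simp_rw [e1]
  refine ne_top_of_le_ne_top (ENNReal.add_ne_top.2 ⟨b1, b3⟩) ?_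
  calc _ ≤ ∫⁻ x, ((S x + 1) * I + ∫⁻ y, S y * κ (dist x y) ∂μ) ∂μ := by
        apply lintegral_mono
        intro x
        simp only
        gcongr
        exact hκI x
    _ = ∫⁻ x, (S x + 1) * I ∂μ + ∫⁻ x, ∫⁻ y, S y * κ (dist x y) ∂μ ∂μ :=
        lintegral_add_left ((hS.add_const _).mul_const _) _
    _ ≤ _ := by gcongr

set_option maxHeartbeats 4000000 in
/-- fractional regularity of the trace. Under (H1), (H2) and (H4′), for an
`H^t`-measurable `Γ″ ⊆ A_{ω,δ} ∩ Γ_t` (`ω < t`) of finite `H^t`-measure, the trace `Tu` belongs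
to `W^{β,p}(Γ″)` for every `0 < β < (t − ω)/p`. -/
theorem statement15 (n : ℕ) (hn : 1 ≤ n) (p t AΓ CΓ δΓ ω : ℝ)
    (hp : 1 ≤ p) (ht : 0 ≤ t) (htn : t < n) (hAΓ : 1 ≤ AΓ) (hCΓ : 1 ≤ CΓ)
    (hδΓ0 : 0 < δΓ) (hδΓ1 : δΓ < 1) (hω : ω < t)
    (Ω : Set (Euc n)) (hΩo : IsOpen Ω) (hΩne : Ω.Nonempty) (hfr : (frontier Ω).Nonempty)
    (Γ : Set (Euc n)) (hΓfr : Γ ⊆ frontier Ω)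
    (θΓ : Euc n → ℝ) (hθ1 : ∀ xb, 1 ≤ θΓ xb) (hθb : ∃ b : ℝ, ∀ xb, θΓ xb ≤ b)
    (s : Euc n → ℝ) (hsm : Measurable s) (hs0 : ∀ x, 0 ≤ s x) (hsb : ∃ b : ℝ, ∀ x, s x ≤ b)
    (lam₀ η₀ : ℝ) (hlam₀ : 0 < lam₀) (hlam₀1 : lam₀ < 1) (hη₀ : 0 < η₀) (hη₀1 : η₀ < 1)
    (H1 : ∀ xb ∈ Γ, IsCorkscrew Ω (Qreg Ω lam₀ (θΓ xb) xb) xb η₀ (θΓ xb) δΓ)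
    (ε : ℝ → ℝ) (hεmono : ∀ a b : ℝ, 0 < a → a ≤ b → b < 1 → ε a ≤ ε b)
    (H2 : ∀ xb ∈ Γ, ConnectedTo Ω (Ω ∩ ball xb δΓ) xb CΓ (θΓ xb) (δΓ / (3 * CΓ)) ε)
    (H4' : ∀ xb ∈ Γ, ∀ ρ : ℝ, 0 < ρ → μH[t] (Γ ∩ ball xb ρ) ≤ ENNReal.ofReal (AΓ * ρ ^ t))
    (u : Euc n → ℝ) (hu : MemN Ω s p u)
    (δ : ℝ) (hδ0 : 0 < δ) (hδΓ' : δ ≤ δΓ)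
    (Γ'' : Set (Euc n)) (hΓ''meas : MeasurableSet Γ'')
    (hΓ''sub : Γ'' ⊆ {xb ∈ Γ | 0 ≤ alphaLow Ω s p θΓ xb δ + ω} ∩ GammaTau Ω s p u Γ t)
    (hΓ''fin : μH[t] Γ'' < ⊤)
    (Tu : Euc n → ℝ) (hTum : AEMeasurable Tu (μH[t].restrict Γ''))
    (hTu : ∀ xb ∈ Γ'', Tendsto (gFun Ω u) (𝓝[Qreg Ω lam₀ (θΓ xb) xb] xb) (𝓝 (Tu xb))) :
    ∀ β : ℝ, 0 < β → β < (t - ω) / p →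
      (∫⁻ xb in Γ'', ENNReal.ofReal (|Tu xb| ^ p) ∂μH[t]) < ⊤ ∧
      (∫⁻ xb in Γ'', ∫⁻ yb in Γ'',
          ENNReal.ofReal (|Tu yb - Tu xb| ^ p / dist yb xb ^ (t + β * p)) ∂μH[t] ∂μH[t]) < ⊤ := by
  intro β hβ0 hβ1
  have hp0 : 0 < p := by linarith
  have hNfin := NUm_fin hu
  obtain ⟨b, hb⟩ := hθb
  obtain ⟨sM, hsM⟩ := hsb
  set NU := NUm Ω s p u with hNU
  obtain ⟨K, hK0, hK⟩ := conn p CΓ δΓ ω hp hCΓ hδΓ1 Ω hΩo Γ hΓfr θΓ hθ1 s hs0 sM hsM ε H2 u hu δ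
    hδΓ' (η₀ / 2) (by linarith) (by linarith)
  rw [← hNU] at hK
  -- scales
  obtain ⟨ρ0, hρ00, hρ01, hρ02⟩ : ∃ ρ0 : ℝ, 0 < ρ0 ∧ ρ0 ≤ δΓ / (6 * CΓ) ∧ ρ0 ≤ δ / (4 * (CΓ + 1)) :=
    ⟨min (δΓ / (6 * CΓ)) (δ / (4 * (CΓ + 1))), lt_min (by positivity) (by positivity),
      min_le_left _ _, min_le_right _ _⟩
  have hρ01' : 2 * ρ0 ≤ δΓ / (3 * CΓ) := by
    have : δΓ / (6 * CΓ) * 2 = δΓ / (3 * CΓ) := by field_simp; norm_num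
    linarith
  have hρ02' : 4 * (CΓ + 1) * ρ0 ≤ δ := by
    rw [le_div_iff₀ (by positivity)] at hρ02; linarith
  have hρ0δ : ρ0 ≤ δΓ := by nlinarith
  set ρ : ℕ → ℝ := fun j => ρ0 * (1 / 2) ^ j with hρ
  have hρpos : ∀ j, 0 < ρ j := fun j => by simp only [hρ]; positivity
  have hρle : ∀ j, ρ j ≤ ρ0 := fun j => by
    simp only [hρ]
    exact mul_le_of_le_one_right hρ00.le (pow_le_one₀ (by norm_num) (by norm_num))
  have hρsucc : ∀ j, ρ (j + 1) = ρ j / 2 := fun j => by simp only [hρ]; ring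
  have hβp : β * p < t - ω := by rwa [lt_div_iff₀ hp0] at hβ1
  have hβp0 : 0 < β * p := by positivity
  obtain ⟨σ, hσ1, hσ2⟩ := exists_between hβp
  have hσ0 : 0 < σ := by linarith
  set R : ℕ → ℝ := fun j => 4 * (CΓ + 1) * ρ j with hR
  have hRpos : ∀ j, 0 < R j := fun j => by have := hρpos j; simp only [hR]; positivity
  set S : Euc n → ℝ≥0∞ := fun x => ∑' j, ENNReal.ofReal (ρ j ^ (-σ - ω)) * NU (ball x (R j)) with hS
  have hSj : ∀ x, S x ≠ ⊤ → ∀ j, ρ j ^ (-ω) * NU.real (ball x (R j)) ≤ ρ j ^ σ * (S x).toReal := by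
    intro x hx j
    have h1 : ENNReal.ofReal (ρ j ^ (-σ - ω)) * NU (ball x (R j)) ≤ S x :=
      ENNReal.le_tsum (f := fun j => ENNReal.ofReal (ρ j ^ (-σ - ω)) * NU (ball x (R j))) j
    have h2 := ENNReal.toReal_mono hx h1
    have hρj := hρpos j
    rw [ENNReal.toReal_mul, ENNReal.toReal_ofReal (by positivity)] at h2
    calc ρ j ^ (-ω) * NU.real (ball x (R j))
        = ρ j ^ σ * (ρ j ^ (-σ - ω) * NU.real (ball x (R j))) := by
          rw [← mul_assoc, ← Real.rpow_add hρj]; ring_nf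
      _ ≤ _ := by gcongr; exact h2
  -- corkscrew points
  have hΓ : ∀ xb ∈ Γ'', xb ∈ Γ := fun xb h => (hΓ''sub h).1.1
  have hαx : ∀ xb ∈ Γ'', 0 ≤ alphaLow Ω s p θΓ xb δ + ω := fun xb h => (hΓ''sub h).1.2
  have hex : ∀ xb ∈ Γ'', ∀ j : ℕ, ∃ x ∈ Qreg Ω lam₀ (θΓ xb) xb, η₀ * ρ j < dist xb x ∧
      dist xb x < ρ j ∧ (η₀ * ρ j) ^ (θΓ xb) < dB Ω x := fun xb hxb j =>
    H1 xb (hΓ xb hxb) (ρ j) (hρpos j) ((hρle j).trans hρ0δ)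
  choose! X hXQ hX1 hX2 hX3 using hex
  have hr1 := half_rpow_lt (σ / p) (by positivity)
  set r := (1 / 2 : ℝ) ^ (σ / p) with hr
  have h1r : 0 < 1 - r := by linarith
  set K3 : ℝ := K / (1 - r) ^ p with hK3
  have hK30 : 0 ≤ K3 := by positivity
  -- convergence
  have hone : ∀ xb ∈ Γ'', S xb ≠ ⊤ → ∀ j,
      |gFun Ω u (X xb j) - Tu xb| ^ p ≤ K3 * ρ j ^ σ * (S xb).toReal := by
    intro xb hxb hSx j
    have hθ0 : 0 ≤ θΓ xb := by linarith [hθ1 xb]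
    have hstep : ∀ j, |gFun Ω u (X xb j) - gFun Ω u (X xb (j + 1))| ^ p ≤
        (K * (S xb).toReal) * ρ j ^ σ := by
      intro j
      have hρj := hρpos j
      have hs := hρsucc j
      have hle := hρle j
      have := hK xb (hΓ xb hxb) (hαx xb hxb) (ρ j) hρj (by linarith) (by nlinarith)
        (X xb j) ⟨(hXQ xb hxb j).1, by rw [mem_ball, dist_comm]; exact hX2 xb hxb j⟩
        (X xb (j + 1)) ⟨(hXQ xb hxb (j + 1)).1, by
          rw [mem_ball, dist_comm]; have := hX2 xb hxb (j + 1); linarith⟩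
        (by
          refine le_trans ?_ (hX3 xb hxb j).le
          apply Real.rpow_le_rpow (by positivity) _ hθ0
          nlinarith)
        (by
          refine le_trans ?_ (hX3 xb hxb (j + 1)).le
          apply Real.rpow_le_rpow (by positivity) _ hθ0
          rw [hs]; nlinarith)
      calc _ ≤ _ := this
        _ ≤ K * ρ j ^ (-ω) * NU.real (ball xb (R j)) := by
          gcongr
          · exact measure_ne_top _ _
          · simp only [hR]; nlinarith
        _ = K * (ρ j ^ (-ω) * NU.real (ball xb (R j))) := by ring
        _ ≤ K * (ρ j ^ σ * (S xb).toReal) :=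
          mul_le_mul_of_nonneg_left (hSj xb hSx j) (by positivity)
        _ = _ := by ring
    have hlim : Tendsto (fun j => gFun Ω u (X xb j)) atTop (𝓝 (Tu xb)) := by
      refine (hTu xb hxb).comp ?_
      rw [tendsto_nhdsWithin_iff]
      refine ⟨?_, Eventually.of_forall fun j => hXQ xb hxb j⟩
      rw [tendsto_iff_dist_tendsto_zero]
      have hz : Tendsto ρ atTop (𝓝 0) := by
        have := (tendsto_pow_atTop_nhds_zero_of_lt_one (r := (1 / 2 : ℝ)) (by norm_num)
          (by norm_num)).const_mul ρ0
        rwa [mul_zero] at this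
      refine squeeze_zero (fun _ => dist_nonneg) (fun j => ?_) hz
      rw [dist_comm]; exact (hX2 xb hxb j).le
    have := geo_sum p σ ρ0 _ (Tu xb) hp hσ0 hρ00 (by positivity) _ hstep hlim j
    refine this.trans (le_of_eq ?_)
    simp only [hK3, hρ, ← hr]
    ring
  -- pairs
  set K4 : ℝ := 3 ^ p * (K3 + K * 2 ^ (-ω)) with hK4
  have hK40 : 0 ≤ K4 := by positivity
  have hmid : ∀ xb ∈ Γ'', ∀ yb ∈ Γ'', θΓ yb ≤ θΓ xb → S xb ≠ ⊤ → S yb ≠ ⊤ → ∀ j,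
      dist yb xb < ρ j → |gFun Ω u (X xb j) - gFun Ω u (X yb j)| ^ p ≤
        K * 2 ^ (-ω) * (ρ j ^ σ * (S xb).toReal) := by
    intro xb hxb yb hyb hθ hSx hSy j hd
    have hρj := hρpos j
    have hle := hρle j
    have hρ1 : ρ j ≤ 1 := by linarith
    have hη : η₀ / 2 * (2 * ρ j) = η₀ * ρ j := by ring
    have := hK xb (hΓ xb hxb) (hαx xb hxb) (2 * ρ j) (by positivity) (by linarith) (by nlinarith)
        (X xb j) ⟨(hXQ xb hxb j).1, by
          rw [mem_ball, dist_comm]; have := hX2 xb hxb j; linarith⟩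
        (X yb j) ⟨(hXQ yb hyb j).1, by
          rw [mem_ball, dist_comm]
          have := hX2 yb hyb j
          have := dist_triangle xb yb (X yb j)
          rw [dist_comm xb yb] at this
          linarith⟩
        (by rw [hη]; exact (hX3 xb hxb j).le)
        (by
          rw [hη]
          refine le_trans ?_ (hX3 yb hyb j).le
          exact Real.rpow_le_rpow_of_exponent_ge (by positivity) (by nlinarith) hθ)
    calc _ ≤ _ := this
      _ = K * 2 ^ (-ω) * (ρ j ^ (-ω) * NU.real (ball xb (R j))) := by
        rw [Real.mul_rpow (by norm_num) hρj.le]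
        have : 2 * (CΓ + 1) * (2 * ρ j) = R j := by simp only [hR]; ring
        rw [this]; ring
      _ ≤ _ :=
          mul_le_mul_of_nonneg_left (hSj xb hSx j) (by positivity)
  have hpair : ∀ xb ∈ Γ'', ∀ yb ∈ Γ'', S xb ≠ ⊤ → S yb ≠ ⊤ → ∀ j,
      dist yb xb < ρ j → |Tu yb - Tu xb| ^ p ≤
        K4 * ρ j ^ σ * ((S xb).toReal + (S yb).toReal) := by
    intro xb hxb yb hyb hSx hSy j hd
    have hρj := hρpos j
    have hx0 : 0 ≤ (S xb).toReal := ENNReal.toReal_nonneg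
    have hy0 : 0 ≤ (S yb).toReal := ENNReal.toReal_nonneg
    set W := ρ j ^ σ * ((S xb).toReal + (S yb).toReal) with hW
    have hW0 : 0 ≤ W := by positivity
    have hWx : ρ j ^ σ * (S xb).toReal ≤ W := by rw [hW]; gcongr; linarith
    have hWy : ρ j ^ σ * (S yb).toReal ≤ W := by rw [hW]; gcongr; linarith
    have hK2 : 0 ≤ K * 2 ^ (-ω) := by positivity
    have a1 : |gFun Ω u (X xb j) - Tu xb| ^ p ≤ (K3 + K * 2 ^ (-ω)) * W := by
      have := hone xb hxb hSx j
      rw [mul_assoc] at this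
      have h2 : K3 * (ρ j ^ σ * (S xb).toReal) ≤ K3 * W := by gcongr
      nlinarith [mul_nonneg hK2 hW0]
    have a2 : |gFun Ω u (X yb j) - Tu yb| ^ p ≤ (K3 + K * 2 ^ (-ω)) * W := by
      have := hone yb hyb hSy j
      rw [mul_assoc] at this
      have h2 : K3 * (ρ j ^ σ * (S yb).toReal) ≤ K3 * W := by gcongr
      nlinarith [mul_nonneg hK2 hW0]
    have a3 : |gFun Ω u (X xb j) - gFun Ω u (X yb j)| ^ p ≤ (K3 + K * 2 ^ (-ω)) * W := by
      have : |gFun Ω u (X xb j) - gFun Ω u (X yb j)| ^ p ≤ K * 2 ^ (-ω) * W := by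
        rcases le_total (θΓ yb) (θΓ xb) with h | h
        · refine (hmid xb hxb yb hyb h hSx hSy j hd).trans ?_
          gcongr
        · rw [abs_sub_comm]
          refine (hmid yb hyb xb hxb h hSy hSx j (by rwa [dist_comm])).trans ?_
          gcongr
      nlinarith [mul_nonneg hK30 hW0]
    have h3 := three_pow p _ _ _ _ hp (abs_nonneg _) (abs_nonneg _) (abs_nonneg _) a2 a3 a1
    calc |Tu yb - Tu xb| ^ p ≤ (|gFun Ω u (X yb j) - Tu yb| +
          |gFun Ω u (X xb j) - gFun Ω u (X yb j)| + |gFun Ω u (X xb j) - Tu xb|) ^ p := by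
          gcongr
          rw [abs_sub_comm (gFun Ω u (X yb j)), abs_sub_comm (gFun Ω u (X xb j)) (gFun Ω u (X yb j))]
          have := abs_sub_le (Tu yb) (gFun Ω u (X yb j)) (Tu xb)
          have := abs_sub_le (gFun Ω u (X yb j)) (gFun Ω u (X xb j)) (Tu xb)
          linarith
      _ ≤ _ := h3
      _ = _ := by rw [hK4, hW]; ring
  -- size
  have hηρ : 0 < η₀ * ρ0 := by positivity
  have hηρ1 : η₀ * ρ0 ≤ 1 := by nlinarith
  obtain ⟨G, hG0, hG⟩ : ∃ G : ℝ, 0 ≤ G ∧ ∀ xb ∈ Γ'', |gFun Ω u (X xb 0)| ≤ G := by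
    have hv := vol_one_pos (n := n)
    have hI : 0 ≤ ∫ y in Ω, |u y| := integral_nonneg fun y => abs_nonneg _
    refine ⟨_, ?_, fun xb hxb => g_bdd hΩo u hu.1 (hXQ xb hxb 0).1 ((η₀ * ρ0) ^ b)
      (by positivity) ?_⟩
    · positivity
    · refine le_trans ?_ (hX3 xb hxb 0).le
      have : ρ 0 = ρ0 := by simp [hρ]
      rw [this]
      exact Real.rpow_le_rpow_of_exponent_ge hηρ hηρ1 (hb xb)
  set K5 : ℝ := 3 ^ p * (K3 * ρ0 ^ σ + G ^ p) with hK5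
  have hK50 : 0 ≤ K5 := by positivity
  have hsize : ∀ xb ∈ Γ'', S xb ≠ ⊤ → |Tu xb| ^ p ≤ K5 * ((S xb).toReal + 1) := by
    intro xb hxb hSx
    have hx0 : 0 ≤ (S xb).toReal := ENNReal.toReal_nonneg
    have h0 := hone xb hxb hSx 0
    have e0 : ρ 0 = ρ0 := by simp [hρ]
    rw [e0] at h0
    have hKρ : 0 ≤ K3 * ρ0 ^ σ := by positivity
    have hGp : 0 ≤ G ^ p := by positivity
    have h1 : |gFun Ω u (X xb 0)| ^ p ≤ G ^ p := by gcongr; exact hG xb hxb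
    have h3 := three_pow p |gFun Ω u (X xb 0) - Tu xb| |gFun Ω u (X xb 0)| 0
      ((K3 * ρ0 ^ σ + G ^ p) * ((S xb).toReal + 1)) hp (abs_nonneg _) (abs_nonneg _) le_rfl
      (by nlinarith [mul_nonneg hGp hx0]) (by nlinarith [mul_nonneg hGp hx0, mul_nonneg hKρ hx0])
      (by rw [Real.zero_rpow hp0.ne']; positivity)
    calc |Tu xb| ^ p ≤ (|gFun Ω u (X xb 0) - Tu xb| + |gFun Ω u (X xb 0)| + 0) ^ p := by
          gcongr
          have := abs_sub_abs_le_abs_sub (Tu xb) (gFun Ω u (X xb 0))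
          rw [abs_sub_comm] at this
          linarith
      _ ≤ _ := h3
      _ = _ := by rw [hK5]; ring
  -- the measure
  set μ : Measure (Euc n) := μH[t].restrict Γ'' with hμ
  have hμfin : IsFiniteMeasure μ := ⟨by rw [hμ, Measure.restrict_apply_univ]; exact hΓ''fin⟩
  have hμball : ∀ (z : Euc n) (r : ℝ), 0 < r → μ (ball z r) ≤ ENNReal.ofReal (AΓ * (2 * r) ^ t) := by
    intro z r hr
    rw [hμ, Measure.restrict_apply measurableSet_ball]
    by_cases hne : (ball z r ∩ Γ'').Nonempty
    · obtain ⟨w, hw, hwΓ⟩ := hne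
      refine le_trans (measure_mono ?_) (H4' w (hΓ w hwΓ) (2 * r) (by positivity))
      rintro y ⟨hy, hyΓ⟩
      refine ⟨hΓ y hyΓ, ?_⟩
      rw [mem_ball] at *
      have := dist_triangle_right y w z
      linarith
    · rw [not_nonempty_iff_eq_empty] at hne
      rw [hne]; simp
  have hSm : Measurable S := by
    apply Measurable.tsum
    intro j
    exact (meas_ball_measurable NU _).const_mul _
  have hSint : ∫⁻ x, S x ∂μ ≠ ⊤ := by
    have e1 : ∫⁻ x, S x ∂μ = ∑' j, ENNReal.ofReal (ρ j ^ (-σ - ω)) * ∫⁻ x, NU (ball x (R j)) ∂μ := by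
      simp only [hS]
      rw [lintegral_tsum fun j => ((meas_ball_measurable NU _).const_mul _).aemeasurable]
      congr 1; ext j
      rw [lintegral_const_mul _ (meas_ball_measurable NU _)]
    have e2 : ∀ j, ENNReal.ofReal (ρ j ^ (-σ - ω)) * ∫⁻ x, NU (ball x (R j)) ∂μ ≤
        ENNReal.ofReal (ρ j ^ (t - ω - σ)) *
          (ENNReal.ofReal (AΓ * (8 * (CΓ + 1)) ^ t) * NU univ) := by
      intro j
      have hρj := hρpos j
      rw [ball_swap]
      calc _ ≤ ENNReal.ofReal (ρ j ^ (-σ - ω)) * ∫⁻ y, ENNReal.ofReal (AΓ * (2 * R j) ^ t) ∂NU := by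
            gcongr with y
            exact hμball y _ (hRpos j)
        _ = _ := by
          have h1 : 2 * R j = 8 * (CΓ + 1) * ρ j := by simp only [hR]; ring
          have h2 : ρ j ^ (t - ω - σ) = ρ j ^ (-σ - ω) * ρ j ^ t := by
            rw [← Real.rpow_add hρj]; ring_nf
          have hreal : ρ j ^ (-σ - ω) * (AΓ * (2 * R j) ^ t) =
              ρ j ^ (t - ω - σ) * (AΓ * (8 * (CΓ + 1)) ^ t) := by
            rw [h1, Real.mul_rpow (by positivity) hρj.le, h2]
            ring
          have hn1 : 0 ≤ ρ j ^ (-σ - ω) := Real.rpow_nonneg hρj.le _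
          have hn2 : 0 ≤ ρ j ^ (t - ω - σ) := Real.rpow_nonneg hρj.le _
          rw [lintegral_const, ← mul_assoc, ← ENNReal.ofReal_mul hn1, hreal,
            ENNReal.ofReal_mul hn2, mul_assoc]
    rw [e1]
    refine ne_top_of_le_ne_top ?_ (ENNReal.tsum_le_tsum e2)
    rw [ENNReal.tsum_mul_right]
    exact ENNReal.mul_ne_top (sum_fin ρ0 _ hρ00 (by linarith))
      (ENNReal.mul_ne_top ENNReal.ofReal_ne_top (measure_ne_top _ _))
  -- kernel
  set κ : ℝ → ℝ≥0∞ := fun d => 1 + ∑' j, ENNReal.ofReal (ρ j ^ (σ - β * p - t)) *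
    (Iio (ρ j)).indicator 1 d with hκ
  have hκm : Measurable κ := by
    apply Measurable.const_add
    apply Measurable.tsum
    intro j
    exact (measurable_one.indicator measurableSet_Iio).const_mul _
  have hκ1 : ∀ d, 1 ≤ κ d := fun d => le_self_add
  obtain ⟨I, hI, hκI⟩ : ∃ I : ℝ≥0∞, I ≠ ⊤ ∧ ∀ x, ∫⁻ y, κ (dist x y) ∂μ ≤ I := by
    refine ⟨μ univ + (∑' j, ENNReal.ofReal (ρ j ^ (σ - β * p))) * ENNReal.ofReal (AΓ * 2 ^ t),
      ENNReal.add_ne_top.2 ⟨measure_ne_top _ _, ENNReal.mul_ne_top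
        (sum_fin ρ0 _ hρ00 (by linarith)) ENNReal.ofReal_ne_top⟩, ?_⟩
    intro x
    have hdm : Measurable (fun y => dist x y) := (continuous_const.dist continuous_id).measurable
    have him : ∀ j, Measurable (fun y => (Iio (ρ j)).indicator (1 : ℝ → ℝ≥0∞) (dist x y)) := fun j =>
      (measurable_one.indicator measurableSet_Iio).comp hdm
    simp only [hκ]
    rw [lintegral_add_left measurable_const, lintegral_one,
      lintegral_tsum fun j => ((him j).const_mul _).aemeasurable, ← ENNReal.tsum_mul_right]
    gcongr with j
    have hρj := hρpos j
    rw [lintegral_const_mul _ (him j)]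
    have e1 : ∫⁻ y, (Iio (ρ j)).indicator (1 : ℝ → ℝ≥0∞) (dist x y) ∂μ = μ (ball x (ρ j)) := by
      rw [← lintegral_indicator_one measurableSet_ball]
      congr 1; ext y
      simp only [indicator, mem_Iio, mem_ball, dist_comm x y, Pi.one_apply]
    rw [e1]
    calc _ ≤ ENNReal.ofReal (ρ j ^ (σ - β * p - t)) * ENNReal.ofReal (AΓ * (2 * ρ j) ^ t) := by
          gcongr; exact hμball x _ hρj
      _ = _ := by
        rw [← ENNReal.ofReal_mul (by positivity), ← ENNReal.ofReal_mul (by positivity)]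
        congr 1
        have h2 : ρ j ^ (σ - β * p) = ρ j ^ (σ - β * p - t) * ρ j ^ t := by
          rw [← Real.rpow_add hρj]; ring_nf
        rw [Real.mul_rpow (by norm_num) hρj.le, h2]
        ring
  have hdouble := double_int μ S hSm κ hκm I hI hκI hSint
  -- final bound on the first integral
  constructor
  · have hb1 : ∀ xb ∈ Γ'', ENNReal.ofReal (|Tu xb| ^ p) ≤ ENNReal.ofReal (K5 + 1) * (S xb + 1) := by
      intro xb hxb
      by_cases hSx : S xb = ⊤
      · rw [hSx, top_add, ENNReal.mul_top (by
          rw [Ne, ENNReal.ofReal_eq_zero]; push Not; linarith)]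
        exact le_top
      · rw [← ENNReal.ofReal_toReal hSx, ← ENNReal.ofReal_one,
          ← ENNReal.ofReal_add ENNReal.toReal_nonneg zero_le_one, ← ENNReal.ofReal_mul (by positivity)]
        apply ENNReal.ofReal_le_ofReal
        have := hsize xb hxb hSx
        have : 0 ≤ (S xb).toReal := ENNReal.toReal_nonneg
        nlinarith
    refine lt_of_le_of_lt (setLIntegral_mono' hΓ''meas hb1) ?_
    rw [← hμ, lintegral_const_mul _ (hSm.add_const _), lintegral_add_right _ measurable_const,
      lintegral_one]
    exact (ENNReal.mul_ne_top ENNReal.ofReal_ne_top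
      (ENNReal.add_ne_top.2 ⟨hSint, measure_ne_top _ _⟩)).lt_top
  · set T := t + β * p with hT
    have hT0 : 0 < T := by linarith
    set K6 : ℝ := K4 * 2 ^ T + 3 ^ p * (2 * K5) / ρ0 ^ T + 1 with hK6
    have hK6a : 0 ≤ K4 * 2 ^ T := by positivity
    have hK6b : 0 ≤ 3 ^ p * (2 * K5) / ρ0 ^ T := by positivity
    have hK60 : 0 < K6 := by positivity
    have hb2 : ∀ xb ∈ Γ'', ∀ yb ∈ Γ'',
        ENNReal.ofReal (|Tu yb - Tu xb| ^ p / dist yb xb ^ T) ≤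
          ENNReal.ofReal K6 * ((S xb + S yb + 1) * κ (dist xb yb)) := by
      intro xb hxb yb hyb
      have hκ0 : κ (dist xb yb) ≠ 0 := (lt_of_lt_of_le one_pos (hκ1 _)).ne'
      have hK6' : ENNReal.ofReal K6 ≠ 0 := by
        rw [Ne, ENNReal.ofReal_eq_zero]; push Not; exact hK60
      by_cases hSx : S xb = ⊤
      · rw [hSx, top_add, top_add, ENNReal.top_mul hκ0, ENNReal.mul_top hK6']
        exact le_top
      by_cases hSy : S yb = ⊤
      · rw [hSy, add_top, top_add, ENNReal.top_mul hκ0, ENNReal.mul_top hK6']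
        exact le_top
      set a := (S xb).toReal with ha
      set c := (S yb).toReal with hc
      have ha0 : 0 ≤ a := ENNReal.toReal_nonneg
      have hc0 : 0 ≤ c := ENNReal.toReal_nonneg
      have hsum : S xb + S yb + 1 = ENNReal.ofReal (a + c + 1) := by
        rw [ENNReal.ofReal_add (by positivity) zero_le_one, ENNReal.ofReal_add ha0 hc0, ha, hc,
          ENNReal.ofReal_toReal hSx, ENNReal.ofReal_toReal hSy, ENNReal.ofReal_one]
      rw [hsum]
      by_cases hd0 : dist yb xb = 0
      · rw [dist_eq_zero] at hd0
        subst hd0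
        simp [Real.zero_rpow hp0.ne']
      have hdpos : 0 < dist yb xb := lt_of_le_of_ne dist_nonneg (Ne.symm hd0)
      rcases le_or_gt ρ0 (dist yb xb) with hfar | hnear
      · have h1 := hsize xb hxb hSx
        have h2 := hsize yb hyb hSy
        rw [← ha] at h1
        rw [← hc] at h2
        have h3 := three_pow p |Tu yb| |Tu xb| 0 (2 * K5 * (a + c + 1)) hp (abs_nonneg _)
          (abs_nonneg _) le_rfl (by nlinarith [mul_nonneg hK50 ha0, mul_nonneg hK50 hc0])
          (by nlinarith [mul_nonneg hK50 ha0, mul_nonneg hK50 hc0])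
          (by rw [Real.zero_rpow hp0.ne']; positivity)
        have h4 : |Tu yb - Tu xb| ^ p ≤ 3 ^ p * (2 * K5 * (a + c + 1)) := by
          refine le_trans ?_ h3
          gcongr
          rw [add_zero]
          exact abs_sub _ _
        calc _ ≤ ENNReal.ofReal (K6 * (a + c + 1)) := by
              apply ENNReal.ofReal_le_ofReal
              calc _ ≤ 3 ^ p * (2 * K5 * (a + c + 1)) / ρ0 ^ T := by gcongr
                _ = 3 ^ p * (2 * K5) / ρ0 ^ T * (a + c + 1) := by ring
                _ ≤ _ := by gcongr; rw [hK6]; linarith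
          _ = ENNReal.ofReal K6 * (ENNReal.ofReal (a + c + 1) * 1) := by
              rw [mul_one, ENNReal.ofReal_mul hK60.le]
          _ ≤ _ := by gcongr; exact hκ1 _
      · obtain ⟨j, hj1, hj2⟩ : ∃ j, ρ (j + 1) ≤ dist yb xb ∧ dist yb xb < ρ j := by
          have hexm : ∃ m, ρ m ≤ dist yb xb := by
            obtain ⟨m, hm⟩ := exists_pow_lt_of_lt_one (div_pos hdpos hρ00) (y := (1 / 2 : ℝ))
              (by norm_num)
            refine ⟨m, ?_⟩
            rw [lt_div_iff₀ hρ00] at hm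
            simp only [hρ]
            linarith
          classical
          have hm1 := Nat.find_spec hexm
          have hm2 : Nat.find hexm ≠ 0 := by
            intro h0
            rw [h0] at hm1
            simp only [hρ, pow_zero, mul_one] at hm1
            linarith
          obtain ⟨j, hj⟩ := Nat.exists_eq_succ_of_ne_zero hm2
          refine ⟨j, by rw [hj] at hm1; exact hm1, ?_⟩
          have := Nat.find_min hexm (m := j) (by rw [hj]; exact Nat.lt_succ_self j)
          exact not_le.1 this
        have hρj := hρpos j
        have h1 := hpair xb hxb yb hyb hSx hSy j hj2
        rw [← ha, ← hc] at h1
        have hκj : ENNReal.ofReal (ρ j ^ (σ - β * p - t)) ≤ κ (dist xb yb) := by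
          have h5 : ENNReal.ofReal (ρ j ^ (σ - β * p - t)) *
              (Iio (ρ j)).indicator (1 : ℝ → ℝ≥0∞) (dist xb yb) ≤
              ∑' j, ENNReal.ofReal (ρ j ^ (σ - β * p - t)) *
                (Iio (ρ j)).indicator (1 : ℝ → ℝ≥0∞) (dist xb yb) :=
            ENNReal.le_tsum (f := fun j => ENNReal.ofReal (ρ j ^ (σ - β * p - t)) *
              (Iio (ρ j)).indicator (1 : ℝ → ℝ≥0∞) (dist xb yb)) j
          rw [indicator_of_mem (by rw [mem_Iio, dist_comm]; exact hj2), Pi.one_apply, mul_one] at h5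
          exact h5.trans le_add_self
        rw [hρsucc] at hj1
        calc _ ≤ ENNReal.ofReal (K6 * ((a + c + 1) * ρ j ^ (σ - β * p - t))) := by
              apply ENNReal.ofReal_le_ofReal
              have hexp : ρ j ^ σ / ρ j ^ T = ρ j ^ (σ - β * p - t) := by
                rw [← Real.rpow_sub hρj, hT]; ring_nf
              calc _ ≤ K4 * ρ j ^ σ * (a + c) / (ρ j / 2) ^ T := by gcongr
                _ = K4 * 2 ^ T * ((a + c) * ρ j ^ (σ - β * p - t)) := by
                  rw [Real.div_rpow hρj.le (by norm_num), ← hexp]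
                  field_simp
                _ ≤ K6 * ((a + c + 1) * ρ j ^ (σ - β * p - t)) := by
                  exact mul_le_mul (by rw [hK6]; linarith)
                    (mul_le_mul_of_nonneg_right (by linarith) (by positivity))
                    (by positivity) hK60.le
          _ = ENNReal.ofReal K6 * (ENNReal.ofReal (a + c + 1) *
                ENNReal.ofReal (ρ j ^ (σ - β * p - t))) := by
              rw [ENNReal.ofReal_mul hK60.le, ENNReal.ofReal_mul (by positivity)]
          _ ≤ _ := by gcongr
    refine lt_of_le_of_lt (setLIntegral_mono' hΓ''meas fun xb hxb =>
      setLIntegral_mono' hΓ''meas fun yb hyb => hb2 xb hxb yb hyb) ?_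
    rw [← hμ]
    simp_rw [lintegral_const_mul' _ _ (ENNReal.ofReal_ne_top (r := K6))]
    exact (ENNReal.mul_ne_top ENNReal.ofReal_ne_top hdouble).lt_top
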